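/- arXiv:2103.02281 — 6 statements merged into one kernel-verified Lean document; each statement's English description precedes it below -/
import Mathlib

section
/- The pessimistic value function Φ : 𝒰 → ℝ defined by Φ[u] := max_{f ∈ Ψ[u]} J[u,f] is well-defined (the maximum over Ψ[u] is attained) and upper semicontinuous on 𝒰. -/
open Matrix Set

/-- The lower-level quadratic objective `f ↦ fᵀ M H[u]⁻¹ M f`. -/
noncomputable def lowerObj {n N : ℕ} (M : Matrix (Fin N) (Fin N) ℝ)
    (H : (Fin n → ℝ) → Matrix (Fin N) (Fin N) ℝ)
    (u : Fin n → ℝ) (f : Fin N → ℝ) : ℝ :=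
  f ⬝ᵥ ((M * (H u)⁻¹ * M) *ᵥ f)

/-- The lower-level optimal value function `ψ[u] = max_{f ∈ ℱ} fᵀ M H[u]⁻¹ M f`. -/
noncomputable def psiVal {n N : ℕ} (M : Matrix (Fin N) (Fin N) ℝ)
    (H : (Fin n → ℝ) → Matrix (Fin N) (Fin N) ℝ)
    (F : Set (Fin N → ℝ)) (u : Fin n → ℝ) : ℝ :=
  sSup (lowerObj M H u '' F)

/-- The lower-level solution set mapping `Ψ[u] = {f ∈ ℱ : fᵀ M H[u]⁻¹ M f = ψ[u]}`. -/
noncomputable def PsiSet {n N : ℕ} (M : Matrix (Fin N) (Fin N) ℝ)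
    (H : (Fin n → ℝ) → Matrix (Fin N) (Fin N) ℝ)
    (F : Set (Fin N → ℝ)) (u : Fin n → ℝ) : Set (Fin N → ℝ) :=
  {f ∈ F | lowerObj M H u f = psiVal M H F u}

/-- The pessimistic value function `Φ[u] = max_{f ∈ Ψ[u]} J[u,f]`. -/
noncomputable def PhiVal {n N : ℕ} (M : Matrix (Fin N) (Fin N) ℝ)
    (H : (Fin n → ℝ) → Matrix (Fin N) (Fin N) ℝ)
    (F : Set (Fin N → ℝ)) (J : (Fin n → ℝ) → (Fin N → ℝ) → ℝ)
    (u : Fin n → ℝ) : ℝ :=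
  sSup ((J u) '' PsiSet M H F u)

/-- Parametric pessimistic selection: maximizing `j x` over the maximizers of `q x` on a compact
set is well-posed and gives an upper semicontinuous value function. -/
theorem isGreatest_and_upperSemicontinuous_sSup_image_argmax {X Y : Type*} [TopologicalSpace X]
    [TopologicalSpace Y] {F : Set Y} (hF : IsCompact F) (hne : F.Nonempty) {q j : X → Y → ℝ}
    (hq : Continuous (fun p : X × Y => q p.1 p.2)) (hj : Continuous (fun p : X × Y => j p.1 p.2)) :
    (∀ x, IsGreatest (j x '' {y ∈ F | q x y = sSup (q x '' F)})
      (sSup (j x '' {y ∈ F | q x y = sSup (q x '' F)}))) ∧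
    UpperSemicontinuous (fun x => sSup (j x '' {y ∈ F | q x y = sSup (q x '' F)})) := by
  have hqx (x : X) : Continuous (q x) := by fun_prop
  have hjx (x : X) : Continuous (j x) := by fun_prop
  have hmax (x : X) : IsGreatest (q x '' F) (sSup (q x '' F)) :=
    (hF.image (hqx x)).isGreatest_sSup (hne.image _)
  have hgr (x : X) : IsGreatest (j x '' {y ∈ F | q x y = sSup (q x '' F)})
      (sSup (j x '' {y ∈ F | q x y = sSup (q x '' F)})) := by
    refine IsCompact.isGreatest_sSup (IsCompact.image ?_ (hjx x)) (Set.Nonempty.image _ ?_)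
    · exact hF.inter_right (isClosed_eq (hqx x) continuous_const)
    · exact (hmax x).1
  refine ⟨hgr, fun x₀ c hc => ?_⟩
  have key : ∀ᶠ x in nhds x₀, ∀ y ∈ F, q x y = sSup (q x '' F) → j x y < c := by
    refine hF.eventually_forall_of_forall_eventually fun y hy => ?_
    by_cases h : q x₀ y = sSup (q x₀ '' F)
    · have hlt : j x₀ y < c := ((hgr x₀).2 ⟨y, ⟨hy, h⟩, rfl⟩).trans_lt hc
      filter_upwards [(hj.tendsto (x₀, y)).eventually_lt_const hlt] with z hz _ using hz
    · obtain ⟨y₀, hy₀, hy₀max⟩ := (hmax x₀).1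
      have hlt : q x₀ y < q x₀ y₀ :=
        hy₀max ▸ lt_of_le_of_ne ((hmax x₀).2 (mem_image_of_mem _ hy)) h
      have hq₀ : Continuous (fun z : X × Y => q z.1 y₀) :=
        hq.comp (continuous_fst.prodMk continuous_const)
      filter_upwards [(hq.tendsto (x₀, y)).eventually_lt (hq₀.tendsto (x₀, y)) hlt]
        with z hz heq
      exact absurd ((hmax z.1).2 (mem_image_of_mem _ hy₀)) (heq ▸ hz).not_ge
  filter_upwards [key] with x hx
  obtain ⟨y, ⟨hyF, hy⟩, hyj⟩ := (hgr x).1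
  exact hyj ▸ hx y hyF hy

theorem stmt3 (n N : ℕ) (hn : 0 < n) (hN : 0 < N)
    (U : Set (Fin n → ℝ)) (hUpos : ∀ u ∈ U, ∀ i, 0 < u i)
    (hUne : U.Nonempty) (hUcl : IsClosed U)
    (M : Matrix (Fin N) (Fin N) ℝ) (hM : M.PosDef)
    (F : Set (Fin N → ℝ)) (hFne : F.Nonempty) (hFconv : Convex ℝ F)
    (hFcomp : IsCompact F)
    (H : (Fin n → ℝ) → Matrix (Fin N) (Fin N) ℝ)
    (hHcont : ContinuousOn H U) (hHpd : ∀ u ∈ U, (H u).PosDef)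
    (J : (Fin n → ℝ) → (Fin N → ℝ) → ℝ)
    (hJ : ContinuousOn (fun p : (Fin n → ℝ) × (Fin N → ℝ) => J p.1 p.2)
      (U ×ˢ Set.univ)) :
    (∀ u ∈ U, IsGreatest ((J u) '' PsiSet M H F u) (PhiVal M H F J u)) ∧
      UpperSemicontinuousOn (PhiVal M H F J) U := by
  have hH : Continuous (fun u : U => H u) := hHcont.domRestrict
  have hHinv : Continuous (fun u : U => (H u)⁻¹) := by
    simp only [Matrix.inv_def, Ring.inverse_eq_inv']
    exact (hH.matrix_det.inv₀ fun u => (hHpd u u.2).det_pos.ne').smul hH.matrix_adjugate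
  have hq : Continuous (fun p : U × (Fin N → ℝ) => lowerObj M H p.1 p.2) := by
    unfold lowerObj
    have hA : Continuous (fun p : U × (Fin N → ℝ) => M * (H p.1)⁻¹ * M) :=
      (continuous_const.matrix_mul (hHinv.comp continuous_fst)).matrix_mul continuous_const
    exact continuous_snd.dotProduct (hA.matrix_mulVec continuous_snd)
  have hj : Continuous (fun p : U × (Fin N → ℝ) => J p.1 p.2) :=
    hJ.comp_continuous (f := fun p : U × (Fin N → ℝ) => ((p.1 : Fin n → ℝ), p.2))
      (by fun_prop) fun p => ⟨p.1.2, mem_univ _⟩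
  obtain ⟨hgr, husc⟩ := isGreatest_and_upperSemicontinuous_sSup_image_argmax hFcomp hFne
    (q := fun u : U => lowerObj M H u) (j := fun u : U => J u) hq hj
  exact ⟨fun u hu => hgr ⟨u, hu⟩, upperSemicontinuousOn_iff_restrict.mp husc⟩
end

section
/- If u ∈ 𝒰 is such that Ψ[u] is a singleton, then the pessimistic value function Φ[u] := max_{f ∈ Ψ[u]} J[u,f] is continuous at u (relative to 𝒰). -/
open Matrix Set

open Topology Filter in
/-- If `q u` has `f₀` as its unique maximizer on the compact set `F`, then for `v` near `u`, all
maximizers of `q v` on `F` are near `f₀`. -/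
lemma eventually_maximizers_subset {X Y : Type*} [TopologicalSpace X] [TopologicalSpace Y]
    {q : X → Y → ℝ} (hq : Continuous fun p : X × Y => q p.1 p.2)
    {F : Set Y} (hF : IsCompact F) {u : X} {f₀ : Y} (hf₀ : {f ∈ F | IsMaxOn (q u) F f} = {f₀})
    {V : Set Y} (hV : V ∈ 𝓝 f₀) :
    ∀ᶠ v in 𝓝 u, {f ∈ F | IsMaxOn (q v) F f} ⊆ V := by
  have h₀ : f₀ ∈ {f ∈ F | IsMaxOn (q u) F f} := by rw [hf₀]; rfl
  have hlt : ∀ f ∈ F, f ≠ f₀ → q u f < q u f₀ := by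
    intro f hf hne
    by_contra! hle
    have hmem : f ∈ {f ∈ F | IsMaxOn (q u) F f} := ⟨hf, fun g hg => (h₀.2 hg).trans hle⟩
    rw [hf₀] at hmem
    exact hne hmem
  have hev : ∀ᶠ v in 𝓝 u, ∀ f ∈ F \ interior V, q v f < q v f₀ := by
    refine (hF.diff isOpen_interior).eventually_forall_of_forall_eventually fun f hf => ?_
    have hne : f ≠ f₀ := fun h => hf.2 (h ▸ mem_interior_iff_mem_nhds.2 hV)
    have hq' : Continuous fun p : X × Y => q p.1 f₀ :=
      hq.comp (continuous_fst.prodMk continuous_const)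
    exact hq.continuousAt.eventually_lt (x₀ := (u, f)) hq'.continuousAt (hlt f hf.1 hne)
  filter_upwards [hev] with v hv f hf
  by_contra hfV
  exact (hv f ⟨hf.1, fun h => hfV (interior_subset h)⟩).not_ge (hf.2 h₀.1)

open Topology Filter in
/-- The supremum of `J` over the maximizers of `q` on a compact set is continuous at every
parameter at which the maximizer is unique. -/
lemma continuousAt_sSup_image_maximizers {X Y : Type*} [TopologicalSpace X] [TopologicalSpace Y]
    {q J : X → Y → ℝ} (hq : Continuous fun p : X × Y => q p.1 p.2)
    {F : Set Y} (hF : IsCompact F) {u : X} {f₀ : Y} (hf₀ : {f ∈ F | IsMaxOn (q u) F f} = {f₀})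
    (hJ : ContinuousAt (fun p : X × Y => J p.1 p.2) (u, f₀)) :
    ContinuousAt (fun v => sSup (J v '' {f ∈ F | IsMaxOn (q v) F f})) u := by
  have h₀ : f₀ ∈ {f ∈ F | IsMaxOn (q u) F f} := by rw [hf₀]; rfl
  rw [ContinuousAt, hf₀, image_singleton, csSup_singleton,
    (nhds_basis_Icc_pos (J u f₀)).tendsto_right_iff]
  intro ε hε
  have hev := hJ.eventually (Icc_mem_nhds (sub_lt_self (J u f₀) hε) (lt_add_of_pos_right _ hε))
  rw [nhds_prod_eq, eventually_prod_iff] at hev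
  obtain ⟨A, hA, B, hB, hAB⟩ := hev
  filter_upwards [hA, eventually_maximizers_subset hq hF hf₀ hB] with v hv hsub
  have hbd : ∀ y ∈ J v '' {f ∈ F | IsMaxOn (q v) F f}, y ∈ Icc (J u f₀ - ε) (J u f₀ + ε) := by
    rintro _ ⟨f, hf, rfl⟩
    exact hAB hv (hsub hf)
  obtain ⟨f, hfF, hf⟩ := hF.exists_isMaxOn ⟨f₀, h₀.1⟩
    (hq.comp (continuous_const.prodMk continuous_id : Continuous fun f => (v, f))).continuousOn
  have hmem : J v f ∈ J v '' {f ∈ F | IsMaxOn (q v) F f} := ⟨f, ⟨hfF, hf⟩, rfl⟩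
  exact ⟨(hbd _ hmem).1.trans (le_csSup ⟨_, fun y hy => (hbd y hy).2⟩ hmem),
    csSup_le ⟨_, hmem⟩ fun y hy => (hbd y hy).2⟩

/-- The lower-level objective is jointly continuous where `H` is continuous and invertible. -/
lemma continuous_lowerObj {n N : ℕ} {U : Set (Fin n → ℝ)} (M : Matrix (Fin N) (Fin N) ℝ)
    {H : (Fin n → ℝ) → Matrix (Fin N) (Fin N) ℝ}
    (hH : ContinuousOn H U) (hdet : ∀ u ∈ U, (H u).det ≠ 0) :
    Continuous fun p : U × (Fin N → ℝ) => lowerObj M H p.1 p.2 := by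
  have hHU : Continuous fun v : U => H v := hH.domRestrict
  have hinv : Continuous fun v : U => (H v)⁻¹ := by
    simp only [Matrix.inv_def, Ring.inverse_eq_inv']
    exact (hHU.matrix_det.inv₀ fun v => hdet v v.2).smul hHU.matrix_adjugate
  have hmat : Continuous fun p : U × (Fin N → ℝ) => M * (H p.1)⁻¹ * M :=
    (continuous_const.matrix_mul (hinv.comp continuous_fst)).matrix_mul continuous_const
  exact continuous_snd.dotProduct (hmat.matrix_mulVec continuous_snd)

/-- `Ψ[u]` is the set of maximizers of the lower-level objective. -/
lemma PsiSet_eq_setOf_isMaxOn {n N : ℕ} {M : Matrix (Fin N) (Fin N) ℝ}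
    {H : (Fin n → ℝ) → Matrix (Fin N) (Fin N) ℝ} {F : Set (Fin N → ℝ)} {u : Fin n → ℝ}
    (hbdd : BddAbove (lowerObj M H u '' F)) :
    PsiSet M H F u = {f ∈ F | IsMaxOn (lowerObj M H u) F f} := by
  ext f
  refine and_congr_right fun hf => ⟨fun h g hg => ?_, fun h => ?_⟩
  · exact (le_csSup hbdd (mem_image_of_mem _ hg)).trans h.ge
  · refine (le_csSup hbdd (mem_image_of_mem _ hf)).antisymm (csSup_le ⟨_, mem_image_of_mem _ hf⟩ ?_)
    rintro _ ⟨g, hg, rfl⟩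
    exact h hg

theorem stmt4 (n N : ℕ) (hn : 0 < n) (hN : 0 < N)
    (U : Set (Fin n → ℝ)) (hUpos : ∀ u ∈ U, ∀ i, 0 < u i)
    (hUne : U.Nonempty) (hUcl : IsClosed U)
    (M : Matrix (Fin N) (Fin N) ℝ) (hM : M.PosDef)
    (F : Set (Fin N → ℝ)) (hFne : F.Nonempty) (hFconv : Convex ℝ F)
    (hFcomp : IsCompact F)
    (H : (Fin n → ℝ) → Matrix (Fin N) (Fin N) ℝ)
    (hHcont : ContinuousOn H U) (hHpd : ∀ u ∈ U, (H u).PosDef)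
    (J : (Fin n → ℝ) → (Fin N → ℝ) → ℝ)
    (hJ : ContinuousOn (fun p : (Fin n → ℝ) × (Fin N → ℝ) => J p.1 p.2)
      (U ×ˢ Set.univ))
    (u : Fin n → ℝ) (hu : u ∈ U)
    (hsingleton : ∃ f : Fin N → ℝ, PsiSet M H F u = {f}) :
    ContinuousWithinAt (PhiVal M H F J) U u := by
  obtain ⟨f₀, hf₀⟩ := hsingleton
  have hq : Continuous fun p : U × (Fin N → ℝ) => lowerObj M H p.1 p.2 :=
    continuous_lowerObj M hHcont fun v hv => (hHpd v hv).det_pos.ne'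
  have hPsi : ∀ v : U, PsiSet M H F v = {f ∈ F | IsMaxOn (lowerObj M H v) F f} := fun v =>
    PsiSet_eq_setOf_isMaxOn (hFcomp.bddAbove_image
      (hq.comp (continuous_const.prodMk continuous_id : Continuous fun f => (v, f))).continuousOn)
  have hJU : Continuous fun p : U × (Fin N → ℝ) => J p.1 p.2 :=
    hJ.comp_continuous (f := fun p : U × (Fin N → ℝ) => ((p.1 : Fin n → ℝ), p.2))
      (by fun_prop) fun p => ⟨p.1.2, mem_univ _⟩
  rw [continuousWithinAt_iff_continuousAt_domRestrict _ hu]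
  have hPhi : U.domRestrict (PhiVal M H F J) =
      fun v : U => sSup (J v '' {f ∈ F | IsMaxOn (lowerObj M H v) F f}) := by
    funext v
    rw [← hPsi v]
    rfl
  rw [hPhi]
  exact continuousAt_sSup_image_maximizers (q := fun v : U => lowerObj M H v)
    (J := fun v : U => J v) hq hFcomp ((hPsi ⟨u, hu⟩).symm.trans hf₀) hJU.continuousAt
end

section
/- In the explicit example with J[u,f] := u·f₁, the pessimistic value function Φ[u] := max_{f ∈ Ψ[u]} J[u,f] satisfies Φ[u] = u for u ≥ 1 and Φ[u] = −u for u < 1; in particular Φ is not lower semicontinuous at u = 1. -/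
open Matrix Set

/-- The matrix `H[u]`, defined as the inverse of `[[1, u-1], [u-1, 1]]`. -/
noncomputable def Hex (u : ℝ) : Matrix (Fin 2) (Fin 2) ℝ :=
  (!![1, u - 1; u - 1, 1])⁻¹

/-- The set of admissible forces `ℱ = [-1,1] × [0,1]`. -/
def Fex : Set (Fin 2 → ℝ) :=
  {f | f 0 ∈ Set.Icc (-1 : ℝ) 1 ∧ f 1 ∈ Set.Icc (0 : ℝ) 1}

/-- The lower-level objective `fᵀ M H[u]⁻¹ M f` with `M = Id`. -/
noncomputable def qex (u : ℝ) (f : Fin 2 → ℝ) : ℝ :=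
  f ⬝ᵥ (((1 : Matrix (Fin 2) (Fin 2) ℝ) * (Hex u)⁻¹ *
    (1 : Matrix (Fin 2) (Fin 2) ℝ)) *ᵥ f)

/-- The lower-level optimal value function `ψ[u] = max_{f ∈ ℱ} fᵀ M H[u]⁻¹ M f`. -/
noncomputable def psiex (u : ℝ) : ℝ :=
  sSup (qex u '' Fex)

/-- The lower-level solution set `Ψ[u] = {f ∈ ℱ : fᵀ M H[u]⁻¹ M f = ψ[u]}`. -/
noncomputable def Psiex (u : ℝ) : Set (Fin 2 → ℝ) :=
  {f ∈ Fex | qex u f = psiex u}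
/-- The pessimistic value function `Φ[u] = max_{f ∈ Ψ[u]} J[u,f]` with `J[u,f] = u·f₁`. -/
noncomputable def Phiex (u : ℝ) : ℝ :=
  sSup ((fun f : Fin 2 → ℝ => u * f 0) '' Psiex u)

theorem qex_eq {u : ℝ} (hu : u ∈ Set.Icc (1/2 : ℝ) (3/2)) (f : Fin 2 → ℝ) :
    qex u f = f 0 ^ 2 + 2 * (u - 1) * (f 0 * f 1) + f 1 ^ 2 := by
  obtain ⟨h₁, h₂⟩ := hu
  have hdet : IsUnit (!![1, u - 1; u - 1, 1] : Matrix (Fin 2) (Fin 2) ℝ).det := by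
    rw [Matrix.det_fin_two_of, isUnit_iff_ne_zero]
    nlinarith
  rw [qex, Hex, Matrix.nonsing_inv_nonsing_inv _ hdet]
  simp [dotProduct, Matrix.mulVec, Fin.sum_univ_two]
  ring

theorem isGreatest_qex_of_one_le {u : ℝ} (hu : u ∈ Set.Icc (1/2 : ℝ) (3/2)) (h : 1 ≤ u) :
    IsGreatest (qex u '' Fex) (2 * u) := by
  refine ⟨⟨![1, 1], by norm_num [Fex], ?_⟩, ?_⟩
  · rw [qex_eq hu]
    norm_num
    ring
  · rintro _ ⟨f, ⟨⟨h₁, h₂⟩, h₃, h₄⟩, rfl⟩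
    rw [qex_eq hu]
    have hp : f 0 * f 1 ≤ 1 := by nlinarith
    nlinarith [mul_nonneg (sub_nonneg.2 h) (sub_nonneg.2 hp)]

theorem isGreatest_qex_of_lt_one {u : ℝ} (hu : u ∈ Set.Icc (1/2 : ℝ) (3/2)) (h : u < 1) :
    IsGreatest (qex u '' Fex) (4 - 2 * u) := by
  refine ⟨⟨![-1, 1], by norm_num [Fex], ?_⟩, ?_⟩
  · rw [qex_eq hu]
    norm_num
    ring
  · rintro _ ⟨f, ⟨⟨h₁, h₂⟩, h₃, h₄⟩, rfl⟩
    rw [qex_eq hu]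
    have hp : 0 ≤ f 0 * f 1 + 1 := by nlinarith
    nlinarith [mul_nonneg (sub_nonneg.2 h.le) hp]

theorem Phiex_of_one_le {u : ℝ} (hu : u ∈ Set.Icc (1/2 : ℝ) (3/2)) (h : 1 ≤ u) :
    Phiex u = u := by
  refine IsGreatest.csSup_eq ⟨⟨![1, 1], ⟨by norm_num [Fex], ?_⟩, by simp⟩, ?_⟩
  · rw [psiex, (isGreatest_qex_of_one_le hu h).csSup_eq, qex_eq hu]
    norm_num
    ring
  · rintro _ ⟨f, ⟨⟨⟨_, h₂⟩, _⟩, _⟩, rfl⟩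
    dsimp only
    nlinarith

theorem Phiex_of_lt_one {u : ℝ} (hu : u ∈ Set.Icc (1/2 : ℝ) (3/2)) (h : u < 1) :
    Phiex u = -u := by
  refine IsGreatest.csSup_eq ⟨⟨![-1, 1], ⟨by norm_num [Fex], ?_⟩, by simp⟩, ?_⟩
  · rw [psiex, (isGreatest_qex_of_lt_one hu h).csSup_eq, qex_eq hu]
    norm_num
    ring
  · rintro _ ⟨f, ⟨⟨⟨h₁, h₂⟩, h₃, h₄⟩, hf⟩, rfl⟩
    rw [psiex, (isGreatest_qex_of_lt_one hu h).csSup_eq, qex_eq hu] at hf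
    have hp : f 0 * f 1 ≤ -1 := by
      have h₅ : 0 ≤ (1 - u) * (-1 - f 0 * f 1) := by nlinarith
      nlinarith [nonneg_of_mul_nonneg_right h₅ (sub_pos.2 h)]
    have hf₀ : f 0 ≤ -1 := by nlinarith
    have hu₀ := hu.1
    dsimp only
    nlinarith

theorem stmt7 :
    (∀ u ∈ Set.Icc (1/2 : ℝ) (3/2),
      (1 ≤ u → Phiex u = u) ∧ (u < 1 → Phiex u = -u)) ∧
    ¬ LowerSemicontinuousWithinAt Phiex (Set.Icc (1/2 : ℝ) (3/2)) 1 := by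
  refine ⟨fun u hu => ⟨Phiex_of_one_le hu, Phiex_of_lt_one hu⟩, fun hlsc => ?_⟩
  have h₁ : Phiex 1 = 1 := Phiex_of_one_le (by norm_num) le_rfl
  have hev := hlsc 0 (by simp [h₁])
  rw [eventually_nhdsWithin_iff, Metric.eventually_nhds_iff] at hev
  obtain ⟨ε, hε, hev⟩ := hev
  have hδ : 0 < min (ε / 2) (1 / 2) := by positivity
  have hδ₁ := min_le_left (ε / 2) (1 / 2)
  have hδ₂ := min_le_right (ε / 2) (1 / 2)
  set δ := min (ε / 2) (1 / 2)
  have hmem : 1 - δ ∈ Set.Icc (1/2 : ℝ) (3/2) := ⟨by linarith, by linarith⟩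
  have hpos : 0 < Phiex (1 - δ) := hev (y := 1 - δ) (by rw [Real.dist_eq, abs_lt]; constructor <;> linarith) hmem
  rw [Phiex_of_lt_one hmem (by linarith)] at hpos
  linarith
end

section
/- For every η > 0, the regularized pessimistic value function Φ_η : 𝒰 → ℝ defined by Φ_η[u] := sup_{f ∈ Ψ_η[u]} J[u,f] is well-defined (real-valued, with Ψ_η[u] nonempty) and lower semicontinuous on 𝒰. -/
open Matrix Set

/-- The set of `η`-optimal lower-level solutions
`Ψ_η[u] = {f ∈ ℱ : ψ[u] - fᵀ M H[u]⁻¹ M f < η}`. -/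
noncomputable def PsiEta {n N : ℕ} (M : Matrix (Fin N) (Fin N) ℝ)
    (H : (Fin n → ℝ) → Matrix (Fin N) (Fin N) ℝ)
    (F : Set (Fin N → ℝ)) (η : ℝ) (u : Fin n → ℝ) : Set (Fin N → ℝ) :=
  {f ∈ F | psiVal M H F u - lowerObj M H u f < η}

/-- The regularized pessimistic value function `Φ_η[u] = sup_{f ∈ Ψ_η[u]} J[u,f]`. -/
noncomputable def PhiEta {n N : ℕ} (M : Matrix (Fin N) (Fin N) ℝ)
    (H : (Fin n → ℝ) → Matrix (Fin N) (Fin N) ℝ)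
    (F : Set (Fin N → ℝ)) (J : (Fin n → ℝ) → (Fin N → ℝ) → ℝ)
    (η : ℝ) (u : Fin n → ℝ) : ℝ :=
  sSup ((J u) '' PsiEta M H F η u)

theorem continuous_lowerObj_restrict {n N : ℕ} (M : Matrix (Fin N) (Fin N) ℝ)
    {H : (Fin n → ℝ) → Matrix (Fin N) (Fin N) ℝ} {U : Set (Fin n → ℝ)}
    (hHcont : ContinuousOn H U) (hdet : ∀ u ∈ U, (H u).det ≠ 0) :
    Continuous fun p : U × (Fin N → ℝ) => lowerObj M H p.1 p.2 := by
  have hH : Continuous fun u : U => H u := continuousOn_iff_continuous_domRestrict.1 hHcont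
  have hinv : Continuous fun u : U => (H u)⁻¹ := by
    simp only [Matrix.inv_def, Ring.inverse_eq_inv']
    exact (hH.matrix_det.inv₀ fun u => hdet u u.2).smul hH.matrix_adjugate
  have hmat : Continuous fun p : U × (Fin N → ℝ) => M * (H p.1)⁻¹ * M :=
    (continuous_const.matrix_mul (hinv.comp continuous_fst)).matrix_mul continuous_const
  exact continuous_snd.dotProduct (hmat.matrix_mulVec continuous_snd)

theorem stmt8 (n N : ℕ) (hn : 0 < n) (hN : 0 < N)
    (U : Set (Fin n → ℝ)) (hUpos : ∀ u ∈ U, ∀ i, 0 < u i)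
    (hUne : U.Nonempty) (hUcl : IsClosed U)
    (M : Matrix (Fin N) (Fin N) ℝ) (hM : M.PosDef)
    (F : Set (Fin N → ℝ)) (hFne : F.Nonempty) (hFconv : Convex ℝ F)
    (hFcomp : IsCompact F)
    (H : (Fin n → ℝ) → Matrix (Fin N) (Fin N) ℝ)
    (hHcont : ContinuousOn H U) (hHpd : ∀ u ∈ U, (H u).PosDef)
    (J : (Fin n → ℝ) → (Fin N → ℝ) → ℝ)
    (hJ : ContinuousOn (fun p : (Fin n → ℝ) × (Fin N → ℝ) => J p.1 p.2)
      (U ×ˢ Set.univ)) :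
    ∀ η : ℝ, 0 < η →
      (∀ u ∈ U, (PsiEta M H F η u).Nonempty ∧
        BddAbove ((J u) '' PsiEta M H F η u)) ∧
      LowerSemicontinuousOn (PhiEta M H F J η) U := by
  intro η hη
  have hg := continuous_lowerObj_restrict M hHcont fun u hu => (hHpd u hu).det_pos.ne'
  have hψ : Continuous fun u : U => psiVal M H F u :=
    hFcomp.continuous_sSup (f := fun (u : U) f => lowerObj M H u f) hg
  have hJ' : Continuous fun p : U × (Fin N → ℝ) => J p.1 p.2 :=
    hJ.comp_continuous (f := fun p : U × (Fin N → ℝ) => ((p.1 : Fin n → ℝ), p.2))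
      (by fun_prop) fun p => ⟨p.1.2, mem_univ _⟩
  have hne : ∀ u ∈ U, (PsiEta M H F η u).Nonempty := by
    intro u hu
    obtain ⟨_, ⟨f, hf, rfl⟩, hlt⟩ :=
      exists_lt_of_lt_csSup (hFne.image (lowerObj M H u)) (sub_lt_self (psiVal M H F u) hη)
    exact ⟨f, hf, by linarith⟩
  have hbdd : ∀ u ∈ U, BddAbove (J u '' PsiEta M H F η u) := by
    intro u hu
    have hcont : Continuous (J u) := hJ'.comp (Continuous.prodMk_right (⟨u, hu⟩ : U))
    exact (hFcomp.image hcont).bddAbove.mono (image_mono fun f hf => hf.1)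
  refine ⟨fun u hu => ⟨hne u hu, hbdd u hu⟩, ?_⟩
  rw [← lowerSemicontinuous_restrict_iff]
  intro u y hy
  obtain ⟨_, ⟨f, ⟨hfF, hfη⟩, rfl⟩, hlt⟩ := exists_lt_of_lt_csSup ((hne u u.2).image _) hy
  have hgap : Continuous fun v : U => psiVal M H F v - lowerObj M H v f :=
    hψ.sub (hg.comp (Continuous.prodMk_left f))
  have hJf : Continuous fun v : U => J v f := hJ'.comp (Continuous.prodMk_left f)
  filter_upwards [hgap.continuousAt.eventually_lt_const hfη,
    hJf.continuousAt.eventually_const_lt hlt] with v hvη hvy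
  exact hvy.trans_le (le_csSup (hbdd v v.2) ⟨f, ⟨hfF, hvη⟩, rfl⟩)
end

section
/- Assume ℱ is a bounded polyhedron with finite nonempty set of extreme points 𝒫, and that there is an open connected set Ũ ⊆ ℝ^n with 𝒰 ⊆ Ũ on which H is real analytic with values in a closed subset of the symmetric positive definite matrices. Then for every pair of extreme points f, f̃ ∈ 𝒫, either the function G[u] := fᵀ M H[u]⁻¹ M f − f̃ᵀ M H[u]⁻¹ M f̃ vanishes identically on 𝒰, or the set B[f,f̃] := {u ∈ 𝒰 : f ∈ Ψ[u] and f̃ ∈ Ψ[u]} has Lebesgue measure zero in ℝ^n. -/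
open Matrix Set

section AnalyticZeroSet

open MeasureTheory Topology

variable {E : Type*} [NormedAddCommGroup E] [NormedSpace ℝ E]

/-- A real analytic function on a convex open set, nonzero at `y`, vanishes only on a null set of
parameters of each line through `y`. -/
theorem AnalyticOnNhd.ae_line_notMem_zeroSet {g : E → ℝ} {B : Set E}
    (hg : AnalyticOnNhd ℝ g B) (hBo : IsOpen B) (hBc : Convex ℝ B) {y : E} (hy : y ∈ B)
    (hgy : g y ≠ 0) (x : E) :
    ∀ᵐ s : ℝ, y + s • x ∉ B ∩ g ⁻¹' {0} := by
  let T : Set ℝ := (fun s : ℝ => y + s • x) ⁻¹' B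
  have hTo : IsOpen T := hBo.preimage (by fun_prop)
  have hTc : Convex ℝ T := by
    intro a ha b hb p q hp hq hpq
    have h := hBc ha hb hp hq hpq
    simp only [T, mem_preimage] at h ⊢
    have heq : y + (p • a + q • b) • x = p • (y + a • x) + q • (y + b • x) := by
      obtain rfl : q = 1 - p := by linarith
      simp only [smul_eq_mul]
      module
    rwa [heq]
  have hh : AnalyticOnNhd ℝ (fun s : ℝ => g (y + s • x)) T := by
    intro s hs
    exact AnalyticAt.fun_comp (hg _ hs) (by fun_prop)
  have h0 : (0 : ℝ) ∈ T := by simpa [T] using hy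
  have hcod := hh.preimage_zero_mem_codiscreteWithin (x := 0) (by simpa using hgy) h0
    ⟨⟨0, h0⟩, hTc.isPreconnected⟩
  have hae := ae_restrict_le_codiscreteWithin (μ := volume) hTo.measurableSet hcod
  filter_upwards [(ae_restrict_iff' hTo.measurableSet).1 hae] with s hs hmem
  exact hs hmem.1 hmem.2

variable [FiniteDimensional ℝ E] [MeasurableSpace E] [BorelSpace E]

theorem AnalyticOnNhd.measure_zeroSet_eq_zero_of_convex (μ : Measure E) [μ.IsAddHaarMeasure]
    {g : E → ℝ} {B : Set E} (hg : AnalyticOnNhd ℝ g B) (hBo : IsOpen B) (hBc : Convex ℝ B)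
    {y : E} (hy : y ∈ B) (hgy : g y ≠ 0) :
    μ (B ∩ g ⁻¹' {0}) = 0 := by
  have hA : MeasurableSet (B ∩ g ⁻¹' {0}) := by
    have h := hBo.measurableSet.diff
      (hg.continuousOn.isOpen_inter_preimage hBo isOpen_compl_singleton
        (t := {(0 : ℝ)}ᶜ)).measurableSet
    convert h using 1
    ext z
    simp only [mem_inter_iff, mem_preimage, mem_sdiff, mem_compl_iff, mem_singleton_iff]
    tauto
  have hswap : ∀ᵐ s : ℝ, ∀ᵐ x ∂μ, y + s • x ∉ B ∩ g ⁻¹' {0} := by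
    refine (Measure.ae_ae_comm (μ := μ) (ν := (volume : Measure ℝ))
      (p := fun x s => y + s • x ∉ B ∩ g ⁻¹' {0}) ?_).1
      (.of_forall (hg.ae_line_notMem_zeroSet hBo hBc hy hgy))
    exact (hA.preimage (f := fun z : E × ℝ => y + z.2 • z.1)
      (Continuous.measurable (by fun_prop))).compl
  obtain ⟨s, hs, hs0⟩ := (hswap.and (Measure.ae_ne volume (0 : ℝ))).exists
  have hs' : μ ((s • ·) ⁻¹' ((y + ·) ⁻¹' (B ∩ g ⁻¹' {0}))) = 0 := by
    simp only [ae_iff, not_not] at hs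
    exact hs
  rw [Measure.addHaar_preimage_smul _ hs0, mul_eq_zero, measure_preimage_add] at hs'
  exact hs'.resolve_left (by simp [hs0])

/-- The zero set of a real analytic function on a connected open set is everything or null. -/
theorem AnalyticOnNhd.eqOn_zero_or_measure_zeroSet_eq_zero (μ : Measure E) [μ.IsAddHaarMeasure]
    {g : E → ℝ} {V : Set E} (hg : AnalyticOnNhd ℝ g V) (hVo : IsOpen V)
    (hVc : IsPreconnected V) :
    EqOn g 0 V ∨ μ (V ∩ g ⁻¹' {0}) = 0 := by
  refine or_iff_not_imp_left.2 fun hne => measure_null_of_locally_null _ fun x hx => ?_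
  obtain ⟨r, hr, hball⟩ := Metric.isOpen_iff.1 hVo x hx.1
  obtain ⟨y, hy, hgy⟩ : ∃ y ∈ Metric.ball x r, g y ≠ 0 := by
    by_contra! h
    refine hne (hg.eqOn_zero_of_preconnected_of_eventuallyEq_zero hVc hx.1 ?_)
    filter_upwards [Metric.ball_mem_nhds x hr] with z hz using h z hz
  refine ⟨Metric.ball x r ∩ g ⁻¹' {0}, ?_, (hg.mono hball).measure_zeroSet_eq_zero_of_convex μ
    Metric.isOpen_ball (convex_ball x r) hy hgy⟩
  filter_upwards [mem_nhdsWithin_of_mem_nhds (Metric.ball_mem_nhds x hr), self_mem_nhdsWithin]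
    with z hz hz' using ⟨hz, hz'.2⟩

end AnalyticZeroSet

section AnalyticMatrix

variable {E m : Type*} [NormedAddCommGroup E] [NormedSpace ℝ E] [Fintype m] [DecidableEq m]

theorem AnalyticAt.matrix_det {A : E → Matrix m m ℝ} {x : E}
    (hA : ∀ i j, AnalyticAt ℝ (fun u => A u i j) x) :
    AnalyticAt ℝ (fun u => (A u).det) x := by
  simp only [Matrix.det_apply']
  exact Finset.analyticAt_fun_sum _ fun σ _ =>
    analyticAt_const.mul (Finset.analyticAt_fun_prod _ fun i _ => hA _ _)

theorem AnalyticAt.matrix_inv_apply {A : E → Matrix m m ℝ} {x : E}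
    (hA : ∀ i j, AnalyticAt ℝ (fun u => A u i j) x) (hx : (A x).det ≠ 0) (i j : m) :
    AnalyticAt ℝ (fun u => (A u)⁻¹ i j) x := by
  simp only [Matrix.inv_def, Ring.inverse_eq_inv', Matrix.smul_apply, smul_eq_mul,
    Matrix.adjugate_apply]
  refine ((AnalyticAt.matrix_det hA).inv hx).mul (AnalyticAt.matrix_det fun k l => ?_)
  simp only [Matrix.updateRow_apply]
  split_ifs
  · exact analyticAt_const
  · exact hA k l

end AnalyticMatrix

theorem analyticAt_lowerObj {n N : ℕ} (M : Matrix (Fin N) (Fin N) ℝ)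
    {H : (Fin n → ℝ) → Matrix (Fin N) (Fin N) ℝ} {u : Fin n → ℝ}
    (hH : ∀ i j, AnalyticAt ℝ (fun u => H u i j) u) (hu : (H u).det ≠ 0) (f : Fin N → ℝ) :
    AnalyticAt ℝ (fun u => lowerObj M H u f) u := by
  simp only [lowerObj, dotProduct, Matrix.mulVec, Matrix.mul_apply]
  exact Finset.analyticAt_fun_sum _ fun i _ => analyticAt_const.mul <|
    Finset.analyticAt_fun_sum _ fun j _ => AnalyticAt.mul
      (Finset.analyticAt_fun_sum _ fun k _ => AnalyticAt.mul
        (Finset.analyticAt_fun_sum _ fun l _ => analyticAt_const.mul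
          (AnalyticAt.matrix_inv_apply hH hu l k)) analyticAt_const) analyticAt_const

open MeasureTheory in
theorem stmt10 (n N : ℕ) (hn : 0 < n) (hN : 0 < N)
    (U : Set (Fin n → ℝ)) (hUpos : ∀ u ∈ U, ∀ i, 0 < u i)
    (hUne : U.Nonempty) (hUcl : IsClosed U)
    (M : Matrix (Fin N) (Fin N) ℝ) (hM : M.PosDef)
    (F : Set (Fin N → ℝ)) (hFne : F.Nonempty) (hFconv : Convex ℝ F)
    (hFcomp : IsCompact F)
    (H : (Fin n → ℝ) → Matrix (Fin N) (Fin N) ℝ)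
    (hHcont : ContinuousOn H U) (hHpd : ∀ u ∈ U, (H u).PosDef)
    -- ℱ is a bounded polyhedron: the convex hull of its nonempty finite
    -- set of extreme points 𝒫
    (P : Set (Fin N → ℝ)) (hPfin : P.Finite) (hPne : P.Nonempty)
    (hFP : F = convexHull ℝ P) (hPext : P = F.extremePoints ℝ)
    -- H is real analytic on an open connected set Ũ ⊇ 𝒰, with values in a
    -- closed subset of the symmetric positive definite matrices
    (Ut : Set (Fin n → ℝ)) (hUtopen : IsOpen Ut) (hUtconn : IsConnected Ut)
    (hUUt : U ⊆ Ut)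
    (hHana : ∀ i j : Fin N, AnalyticOnNhd ℝ (fun u => H u i j) Ut)
    (hHcl : ∃ C : Set (Matrix (Fin N) (Fin N) ℝ), IsClosed C ∧
      (∀ A ∈ C, A.PosDef) ∧ ∀ u ∈ Ut, H u ∈ C) :
    ∀ f ∈ P, ∀ ftilde ∈ P,
      (∀ u ∈ U, lowerObj M H u f - lowerObj M H u ftilde = 0) ∨
      volume {u : Fin n → ℝ |
        u ∈ U ∧ f ∈ PsiSet M H F u ∧ ftilde ∈ PsiSet M H F u} = 0 := by
  intro f _ g _
  obtain ⟨C, -, hCpd, hHC⟩ := hHcl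
  have hana : AnalyticOnNhd ℝ (fun u => lowerObj M H u f - lowerObj M H u g) Ut := fun u hu =>
    have hdet : (H u).det ≠ 0 := (hCpd _ (hHC u hu)).det_pos.ne'
    (analyticAt_lowerObj M (fun i j => hHana i j u hu) hdet f).sub
      (analyticAt_lowerObj M (fun i j => hHana i j u hu) hdet g)
  refine (hana.eqOn_zero_or_measure_zeroSet_eq_zero volume hUtopen hUtconn.isPreconnected).imp
    (fun h u hu => h (hUUt hu)) (measure_mono_null ?_)
  rintro u ⟨hu, hf, hg⟩
  exact ⟨hUUt hu, sub_eq_zero.2 (hf.2.trans hg.2.symm)⟩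
end

section
/- Let (Ω, ℬ, ℙ) be a probability space, p ∈ [1,∞), and ℛ : L^p(Ω, ℬ, ℙ) → ℝ a function that is convex and monotone, in the sense that ℛ[Y₁] ≤ ℛ[Y₂] whenever Y₁ ≤ Y₂ ℙ-almost surely. Then ℛ is continuous with respect to the L^p-norm. -/
open MeasureTheory ENNReal

/-- On a complete normed lattice, a monotone real-valued function is bounded above near `0`. -/
theorem Monotone.isBoundedUnder_nhds_zero {E : Type*} [NormedAddCommGroup E] [Lattice E]
    [HasSolidNorm E] [IsOrderedAddMonoid E] [CompleteSpace E] {f : E → ℝ} (hf : Monotone f) :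
    (nhds (0 : E)).IsBoundedUnder (· ≤ ·) f := by
  by_contra h
  have hlarge : ∀ n : ℕ, ∃ y : E, ‖y‖ < (1 / 2 : ℝ) ^ n ∧ (n : ℝ) < f y := by
    intro n
    by_contra! hn
    refine h ⟨n, Filter.eventually_map.2 ?_⟩
    filter_upwards [Metric.ball_mem_nhds (0 : E) (show (0 : ℝ) < (1 / 2) ^ n by positivity)]
      with y hy
    exact hn y (by simpa using hy)
  choose y hy_norm hy_large using hlarge
  have hsum : Summable fun n ↦ |y n| :=
    Summable.of_norm_bounded summable_geometric_two fun n ↦ by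
      simpa only [norm_abs_eq_norm] using (hy_norm n).le
  obtain ⟨n, hn⟩ := exists_nat_gt (f (∑' n, |y n|))
  have hle : y n ≤ ∑' n, |y n| :=
    (le_abs_self _).trans (hsum.le_tsum n fun _ _ ↦ abs_nonneg _)
  exact (hy_large n).not_ge ((hf hle).trans hn.le)

/-- On a complete normed lattice, a monotone convex real-valued function is continuous. -/
theorem ConvexOn.continuous_of_monotone {E : Type*} [NormedAddCommGroup E] [NormedSpace ℝ E]
    [Lattice E] [HasSolidNorm E] [IsOrderedAddMonoid E] [CompleteSpace E] {f : E → ℝ}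
    (hconv : ConvexOn ℝ Set.univ f) (hf : Monotone f) : Continuous f := by
  rw [← continuousOn_univ]
  refine ((hconv.continuousOn_tfae isOpen_univ Set.univ_nonempty).out 3 1).mp ?_
  exact ⟨0, Set.mem_univ _, hf.isBoundedUnder_nhds_zero⟩

/-- A convex function `ℛ : L^p(Ω, ℬ, ℙ) → ℝ`, `p ∈ [1,∞)`, that is monotone
with respect to the ℙ-almost-sure pointwise order is continuous. -/
theorem stmt14 {Ω : Type*} [MeasurableSpace Ω]
    (Pr : Measure Ω) [IsProbabilityMeasure Pr]
    (p : ℝ≥0∞) [Fact (1 ≤ p)] (hp : p ≠ ⊤)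
    (R : Lp ℝ p Pr → ℝ)
    (hconv : ConvexOn ℝ Set.univ R)
    (hmono : ∀ Y₁ Y₂ : Lp ℝ p Pr,
      (Y₁ : Ω → ℝ) ≤ᵐ[Pr] (Y₂ : Ω → ℝ) → R Y₁ ≤ R Y₂) :
    Continuous R :=
  hconv.continuous_of_monotone fun _ _ h ↦ hmono _ _ (Lp.coeFn_le _ _ |>.2 h)
end
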